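/- The set B = {φ₁+φ₂+2φ₃, −(φ₁+φ₂+φ₃+φ₄), φ₂, φ₄} is a base of Δ, and the positive system determined by B equals Δ_k⁺ ∪ {β ∈ Δ_n⁺ : β ≥ φ₁+φ₂+2φ₃} ∪ (−{β ∈ Δ_n⁺ : β ≤ φ₁+φ₂+φ₃+φ₄}); in particular this positive system contains Δ_k⁺. -/

import Mathlib

noncomputable section

abbrev V : Type := Fin 4 → ℝ

def e (i : Fin 4) : V := Pi.single i 1

/-- The root system of type F₄ in ℝ⁴ (48 vectors). -/
def Δ : Set V :=
  (⋃ i, ({e i, -e i} : Set V)) ∪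
  (⋃ (i) (j) (_ : i < j), ({e i + e j, e i - e j, -e i + e j, -e i - e j} : Set V)) ∪
  {v | ∃ s : Fin 4 → ℝ, (∀ i, s i = 1 ∨ s i = -1) ∧ v = (1 / 2 : ℝ) • ∑ i, s i • e i}

def φ₁ : V := e 1 - e 2
def φ₂ : V := e 2 - e 3
def φ₃ : V := e 3
def φ₄ : V := (1 / 2 : ℝ) • (e 0 - e 1 - e 2 - e 3)

def φv : Fin 4 → V := ![φ₁, φ₂, φ₃, φ₄]

/-- The coordinates `n₁(α), …, n₄(α)` of `α` with respect to the basis φ₁,…,φ₄: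
for every `α : V` one has `α = ∑ i, n α i • φv i`. -/
def n (α : V) : Fin 4 → ℝ :=
  ![α 1 + α 0, α 1 + α 2 + 2 * α 0, α 1 + α 2 + α 3 + 3 * α 0, 2 * α 0]

/-- The highest root δ = 2φ₁+3φ₂+4φ₃+2φ₄ = e₁+e₂. -/
def δ : V := e 0 + e 1

/-- Compact roots: roots α with n₁(α) even. -/
def Δk : Set V := {α ∈ Δ | ∃ m : ℤ, n α 0 = 2 * m}

/-- Noncompact roots: roots α with n₁(α) odd. -/
def Δn : Set V := {α ∈ Δ | ∃ m : ℤ, n α 0 = 2 * m + 1}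

/-- Δ⁺: roots with all φ-coefficients nonnegative. -/
def Δp : Set V := {α ∈ Δ | ∀ i, 0 ≤ n α i}

def Δkp : Set V := Δp ∩ Δk
def Δnp : Set V := Δp ∩ Δn

/-- A positive system of Δ: the set of roots on which some root-regular linear
functional is positive. -/
def IsPosSystem (P : Set V) : Prop :=
  ∃ f : V →ₗ[ℝ] ℝ, (∀ α ∈ Δ, f α ≠ 0) ∧ P = {α ∈ Δ | 0 < f α}

/-- `le' γ β` means γ ≤ β, i.e. β − γ is a nonnegative integer combination of φ₁,…,φ₄. -/
def le' (γ β : V) : Prop := ∃ c : Fin 4 → ℕ, β - γ = ∑ i, (c i : ℝ) • φv i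

/-- A base of Δ: a linearly independent subset of Δ such that every root is an
integral combination with coefficients all ≥ 0 or all ≤ 0. -/
def IsBase (B : Finset V) : Prop :=
  ↑B ⊆ Δ ∧ LinearIndependent ℝ (Subtype.val : {x : V // x ∈ B} → V) ∧
  ∀ α ∈ Δ, ∃ c : V → ℤ,
    α = ∑ x ∈ B, (c x : ℝ) • x ∧ ((∀ x ∈ B, 0 ≤ c x) ∨ (∀ x ∈ B, c x ≤ 0))

/-- The positive system determined by a base B: roots whose B-coefficients are all ≥ 0. -/
def posOf (B : Finset V) : Set V :=
  {α ∈ Δ | ∃ c : V → ℤ, α = ∑ x ∈ B, (c x : ℝ) • x ∧ ∀ x ∈ B, 0 ≤ c x}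

theorem n_injective : Function.Injective n := by
  intro α β h
  have h0 := congrFun h 0
  have h1 := congrFun h 1
  have h2 := congrFun h 2
  have h3 := congrFun h 3
  simp only [n, Matrix.cons_val] at h0 h1 h2 h3
  ext i
  fin_cases i <;> simp only [Fin.zero_eta, Fin.mk_one, Fin.reduceFinMk] <;> linarith

theorem n_neg (α : V) : n (-α) = -n α := by
  ext i
  fin_cases i <;> simp [n] <;> ring

theorem n_sub (α β : V) : n (α - β) = n α - n β := by
  ext i
  fin_cases i <;> simp [n] <;> ring

theorem n_sum_smul_φv (k : Fin 4 → ℝ) : n (∑ i, k i • φv i) = k := by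
  ext i
  fin_cases i <;> simp [n, φv, φ₁, φ₂, φ₃, φ₄, e, Fin.sum_univ_four] <;> ring

theorem neg_mem_Δ {α : V} (h : α ∈ Δ) : -α ∈ Δ := by
  simp only [Δ, Set.mem_union, Set.mem_iUnion, Set.mem_insert_iff, Set.mem_singleton_iff,
    Set.mem_ofPred_eq] at h ⊢
  rcases h with (⟨i, rfl | rfl⟩ | ⟨i, j, hij, rfl | rfl | rfl | rfl⟩) | ⟨s, hs, rfl⟩
  · exact .inl (.inl ⟨i, by simp⟩)
  · exact .inl (.inl ⟨i, by simp⟩)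
  · exact .inl (.inr ⟨i, j, hij, .inr (.inr (.inr (by abel)))⟩)
  · exact .inl (.inr ⟨i, j, hij, .inr (.inr (.inl (by abel)))⟩)
  · exact .inl (.inr ⟨i, j, hij, .inr (.inl (by abel))⟩)
  · exact .inl (.inr ⟨i, j, hij, .inl (by abel)⟩)
  · refine .inr ⟨-s, fun i => ?_, by simp⟩
    rcases hs i with h | h <;> simp [h]

/-- The members of the base, in the order in which the statement lists them. -/
def baseVec : Fin 4 → V :=
  ![φ₁ + φ₂ + (2 : ℝ) • φ₃, -(φ₁ + φ₂ + φ₃ + φ₄), φ₂, φ₄]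

/-- The coordinates with respect to `baseVec` of the vector with `φv`-coordinates `m`. -/
def baseCoeff (m : Fin 4 → ℤ) : Fin 4 → ℤ :=
  ![m 2 - m 0, m 2 - 2 * m 0, m 1 - m 0, m 3 + m 2 - 2 * m 0]

theorem n_sum_smul_baseVec (k : Fin 4 → ℝ) :
    n (∑ i, k i • baseVec i) = ![k 0 - k 1, k 0 - k 1 + k 2, 2 * k 0 - k 1, k 3 - k 1] := by
  ext i
  fin_cases i <;>
    simp [n, baseVec, φ₁, φ₂, φ₃, φ₄, e, Fin.sum_univ_four] <;> ring

theorem linearIndependent_baseVec : LinearIndependent ℝ baseVec := by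
  rw [Fintype.linearIndependent_iff]
  intro g hg
  have h := n_sum_smul_baseVec g
  rw [hg] at h
  have h0 := congrFun h 0
  have h1 := congrFun h 1
  have h2 := congrFun h 2
  have h3 := congrFun h 3
  simp [n] at h0 h1 h2 h3
  intro i
  fin_cases i <;> simp only [Fin.zero_eta, Fin.mk_one, Fin.reduceFinMk] <;> linarith

theorem eq_sum_smul_baseVec_iff {α : V} {m : Fin 4 → ℤ} (hm : ∀ i, n α i = m i)
    (k : Fin 4 → ℤ) : α = ∑ i, (k i : ℝ) • baseVec i ↔ k = baseCoeff m := by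
  rw [← n_injective.eq_iff, n_sum_smul_baseVec, funext hm]
  constructor
  · intro h
    have h0 := congrFun h 0
    have h1 := congrFun h 1
    have h2 := congrFun h 2
    have h3 := congrFun h 3
    simp only [Matrix.cons_val] at h0 h1 h2 h3
    norm_cast at h0 h1 h2 h3
    ext i
    fin_cases i <;> simp [baseCoeff] <;> omega
  · rintro rfl
    ext i
    fin_cases i <;> simp [baseCoeff] <;> ring

theorem base_eq_image_baseVec :
    ({φ₁ + φ₂ + (2 : ℝ) • φ₃, -(φ₁ + φ₂ + φ₃ + φ₄), φ₂, φ₄} : Finset V) =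
      Finset.univ.image baseVec := by
  ext v
  simp [baseVec, Fin.exists_fin_succ, eq_comm]

/-- A function on the range of `baseVec` amounts to a function on the indices. -/
theorem exists_coeff_iff (α : V) (p : ℤ → Prop) :
    (∃ c : V → ℤ, α = ∑ x ∈ Finset.univ.image baseVec, (c x : ℝ) • x ∧
      ∀ x ∈ Finset.univ.image baseVec, p (c x)) ↔
    ∃ k : Fin 4 → ℤ, α = ∑ i, (k i : ℝ) • baseVec i ∧ ∀ i, p (k i) := by
  have inj := linearIndependent_baseVec.injective
  constructor
  · rintro ⟨c, hα, hc⟩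
    rw [Finset.sum_image inj.injOn] at hα
    exact ⟨c ∘ baseVec, hα, fun i => hc _ (Finset.mem_image_of_mem _ (Finset.mem_univ i))⟩
  · rintro ⟨k, hα, hk⟩
    refine ⟨Function.extend baseVec k 0, ?_, ?_⟩
    · rw [Finset.sum_image inj.injOn]
      simpa only [inj.extend_apply] using hα
    · simpa [inj.extend_apply] using hk

/-- The properties of the `φv`-coordinates of positive roots on which the description of
the positive system rests. -/
def IsPosCoord (m : Fin 4 → ℤ) : Prop :=
  (∀ i, 0 ≤ m i) ∧ (∃ i, 0 < m i) ∧
    ((m 0 % 2 = 0 ∧ ∀ i, 0 ≤ baseCoeff m i) ∨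
      (m 0 = 1 ∧ 1 ≤ m 1 ∧ 2 ≤ m 2 ∧ ∀ i, 0 ≤ baseCoeff m i) ∨
      (m 0 = 1 ∧ m 1 ≤ 1 ∧ m 2 ≤ 1 ∧ m 3 ≤ 1 ∧ ∀ i, baseCoeff m i ≤ 0))

instance : DecidablePred IsPosCoord := fun m => by
  unfold IsPosCoord
  infer_instance

/-- The `φv`-coordinates of the vector `u / 2`, if they are integers. -/
def halfCoord (u : Fin 4 → ℤ) : Fin 4 → ℤ :=
  ![(u 1 + u 0) / 2, (u 1 + u 2) / 2 + u 0, (u 1 + u 2 + u 3 + 3 * u 0) / 2, u 0]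

/-- The vector `u / 2` has integral `φv`-coordinates, like those of a root. -/
def IsHalfRoot (u : Fin 4 → ℤ) : Prop :=
  2 ∣ u 1 + u 0 ∧ 2 ∣ u 1 + u 2 ∧ 2 ∣ u 1 + u 2 + u 3 + 3 * u 0 ∧
    (IsPosCoord (halfCoord u) ∨ IsPosCoord (-halfCoord u))

instance : DecidablePred IsHalfRoot := fun u => by
  unfold IsHalfRoot
  infer_instance

theorem n_eq_halfCoord {α : V} {u : Fin 4 → ℤ} (hα : ∀ i, α i = u i / 2)
    (hu : IsHalfRoot u) (i : Fin 4) : n α i = halfCoord u i := by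
  obtain ⟨⟨a, ha⟩, ⟨b, hb⟩, ⟨c, hc⟩, -⟩ := hu
  simp only [halfCoord, hc]
  simp only [ha, hb, n, hα]
  rify at ha hb hc
  fin_cases i <;> simp <;> linarith

theorem isHalfRoot_single : ∀ i : Fin 4,
    IsHalfRoot (Pi.single i 2) ∧ IsHalfRoot (-Pi.single i 2) := by
  decide

theorem isHalfRoot_pair : ∀ i j : Fin 4, i < j →
    IsHalfRoot (Pi.single i 2 + Pi.single j 2) ∧ IsHalfRoot (Pi.single i 2 - Pi.single j 2) ∧
    IsHalfRoot (-Pi.single i 2 + Pi.single j 2) ∧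
    IsHalfRoot (-Pi.single i 2 - Pi.single j 2) := by
  decide

theorem isHalfRoot_sign : ∀ t : Fin 4 → Bool, IsHalfRoot fun i => if t i then 1 else -1 := by
  decide

theorem exists_isHalfRoot {α : V} (h : α ∈ Δ) :
    ∃ u, IsHalfRoot u ∧ ∀ i, α i = u i / 2 := by
  have he (i j : Fin 4) : e i j = ((Pi.single i 2 : Fin 4 → ℤ) j : ℝ) / 2 := by
    by_cases hij : j = i
    · subst hij
      simp [e]
    · simp [e, hij]
  simp only [Δ, Set.mem_union, Set.mem_iUnion, Set.mem_insert_iff, Set.mem_singleton_iff,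
    Set.mem_ofPred_eq] at h
  rcases h with (⟨i, rfl | rfl⟩ | ⟨i, j, hij, h⟩) | ⟨s, hs, rfl⟩
  · exact ⟨_, (isHalfRoot_single i).1, he i⟩
  · exact ⟨_, (isHalfRoot_single i).2, fun k => by simp [he, neg_div]⟩
  · obtain ⟨h₁, h₂, h₃, h₄⟩ := isHalfRoot_pair i j hij
    rcases h with rfl | rfl | rfl | rfl
    · exact ⟨_, h₁, fun k => by simp only [Pi.add_apply, he]; push_cast; ring⟩
    · exact ⟨_, h₂, fun k => by simp only [Pi.sub_apply, he]; push_cast; ring⟩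
    · exact ⟨_, h₃, fun k => by simp only [Pi.add_apply, Pi.neg_apply, he]; push_cast; ring⟩
    · exact ⟨_, h₄, fun k => by simp only [Pi.sub_apply, Pi.neg_apply, he]; push_cast; ring⟩
  · refine ⟨_, isHalfRoot_sign fun i => decide (s i = 1), fun i => ?_⟩
    have hsum : (∑ j, s j • e j) i = s i := by
      simp [e, Finset.sum_apply, Pi.single_apply]
    rw [Pi.smul_apply, hsum]
    rcases hs i with h | h <;> norm_num [h]

/-- The integral `φv`-coordinates of a root. -/
theorem exists_coord {α : V} (h : α ∈ Δ) :
    ∃ m : Fin 4 → ℤ, (∀ i, n α i = m i) ∧ (IsPosCoord m ∨ IsPosCoord (-m)) := by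
  obtain ⟨u, hu, hα⟩ := exists_isHalfRoot h
  exact ⟨_, n_eq_halfCoord hα hu, hu.2.2.2⟩

theorem baseCoeff_neg (m : Fin 4 → ℤ) : baseCoeff (-m) = -baseCoeff m := by
  ext i
  fin_cases i <;> simp [baseCoeff] <;> ring

theorem le'_iff {β γ : V} {k m : Fin 4 → ℤ} (hβ : ∀ i, n β i = k i) (hγ : ∀ i, n γ i = m i) :
    le' β γ ↔ ∀ i, k i ≤ m i := by
  have key (c : Fin 4 → ℕ) : γ - β = ∑ i, (c i : ℝ) • φv i ↔ ∀ i, m i - k i = c i := by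
    rw [← n_injective.eq_iff, n_sub, n_sum_smul_φv, funext_iff]
    refine forall_congr' fun i => ?_
    rw [Pi.sub_apply, hβ, hγ]
    norm_cast
  simp only [le', key]
  constructor
  · rintro ⟨c, hc⟩ i
    have := hc i
    omega
  · intro h
    refine ⟨fun i => (m i - k i).toNat, fun i => ?_⟩
    exact (Int.toNat_of_nonneg (sub_nonneg.2 (h i))).symm

theorem mem_Δkp_iff {α : V} {m : Fin 4 → ℤ} (hα : α ∈ Δ) (hm : ∀ i, n α i = m i) :
    α ∈ Δkp ↔ (∀ i, 0 ≤ m i) ∧ m 0 % 2 = 0 := by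
  simp only [Δkp, Δp, Δk, Set.mem_inter_iff, Set.mem_ofPred_eq, hα, hm, true_and]
  norm_cast
  exact and_congr_right' ⟨fun ⟨k, hk⟩ => by omega, fun h => ⟨m 0 / 2, by omega⟩⟩

theorem mem_Δnp_iff {α : V} {m : Fin 4 → ℤ} (hα : α ∈ Δ) (hm : ∀ i, n α i = m i) :
    α ∈ Δnp ↔ (∀ i, 0 ≤ m i) ∧ m 0 % 2 = 1 := by
  simp only [Δnp, Δp, Δn, Set.mem_inter_iff, Set.mem_ofPred_eq, hα, hm, true_and]
  norm_cast
  exact and_congr_right' ⟨fun ⟨k, hk⟩ => by omega, fun h => ⟨m 0 / 2, by omega⟩⟩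

theorem mem_posOf_iff {α : V} {m : Fin 4 → ℤ} (hα : α ∈ Δ) (hm : ∀ i, n α i = m i) :
    α ∈ posOf (Finset.univ.image baseVec) ↔ ∀ i, 0 ≤ baseCoeff m i := by
  simp only [posOf, Set.mem_ofPred_eq, hα, true_and, exists_coeff_iff α (0 ≤ ·),
    eq_sum_smul_baseVec_iff hm, exists_eq_left]

theorem baseVec_mem_Δ (i : Fin 4) : baseVec i ∈ Δ := by
  fin_cases i
  · refine .inl (.inr ?_)
    simp only [Set.mem_iUnion]
    refine ⟨1, 3, by decide, .inl ?_⟩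
    ext j
    fin_cases j <;> simp [baseVec, φ₁, φ₂, φ₃, e]
    norm_num
  · refine .inr ⟨![-1, -1, 1, 1], fun j => by fin_cases j <;> simp, ?_⟩
    ext j
    fin_cases j <;> simp [baseVec, φ₁, φ₂, φ₃, φ₄, e, Fin.sum_univ_four]
    norm_num
  · refine .inl (.inr ?_)
    simp only [Set.mem_iUnion]
    exact ⟨2, 3, by decide, .inr (.inl rfl)⟩
  · refine .inr ⟨![1, -1, -1, -1], fun j => by fin_cases j <;> simp, ?_⟩
    ext j
    fin_cases j <;> simp [baseVec, φ₄, e, Fin.sum_univ_four]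

theorem isBase_image_baseVec : IsBase (Finset.univ.image baseVec) := by
  refine ⟨?_, ?_, fun α hα => ?_⟩
  · rintro v hv
    obtain ⟨i, -, rfl⟩ := Finset.mem_image.1 (Finset.mem_coe.1 hv)
    exact baseVec_mem_Δ i
  · have h : LinearIndepOn ℝ id (Set.range baseVec) :=
      linearIndependent_baseVec.linearIndepOn_id
    have hcoe : Set.range baseVec = {x | x ∈ Finset.univ.image baseVec} := by
      ext v
      simp
    rw [hcoe] at h
    exact h
  · obtain ⟨m, hm, hpos⟩ := exists_coord hα
    have hrep := (eq_sum_smul_baseVec_iff hm _).2 rfl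
    have hsign : (∀ i, 0 ≤ baseCoeff m i) ∨ ∀ i, baseCoeff m i ≤ 0 := by
      simp only [IsPosCoord, baseCoeff_neg, Pi.neg_apply, neg_nonneg, neg_nonpos] at hpos
      tauto
    rcases hsign with h | h
    · obtain ⟨c, hc, hc0⟩ := (exists_coeff_iff α (0 ≤ ·)).2 ⟨_, hrep, h⟩
      exact ⟨c, hc, .inl hc0⟩
    · obtain ⟨c, hc, hc0⟩ := (exists_coeff_iff α (· ≤ 0)).2 ⟨_, hrep, h⟩
      exact ⟨c, hc, .inr hc0⟩

theorem n_short_bound (i : Fin 4) :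
    n (φ₁ + φ₂ + φ₃ + φ₄) i = ((![1, 1, 1, 1] : Fin 4 → ℤ) i : ℝ) := by
  fin_cases i <;> simp [n, φ₁, φ₂, φ₃, φ₄, e] <;> norm_num

theorem n_long_bound (i : Fin 4) :
    n (φ₁ + φ₂ + (2 : ℝ) • φ₃) i = ((![1, 1, 2, 0] : Fin 4 → ℤ) i : ℝ) := by
  fin_cases i <;> simp [n, φ₁, φ₂, φ₃, e]

theorem posOf_image_baseVec :
    posOf (Finset.univ.image baseVec) =
      Δkp ∪ {β ∈ Δnp | le' (φ₁ + φ₂ + (2 : ℝ) • φ₃) β} ∪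
        (Neg.neg '' {β ∈ Δnp | le' β (φ₁ + φ₂ + φ₃ + φ₄)}) := by
  have hΔ {α : V} (hα : α ∈ Δ) : α ∈ posOf (Finset.univ.image baseVec) ↔
      α ∈ Δkp ∪ {β ∈ Δnp | le' (φ₁ + φ₂ + (2 : ℝ) • φ₃) β} ∪
        (Neg.neg '' {β ∈ Δnp | le' β (φ₁ + φ₂ + φ₃ + φ₄)}) := by
    obtain ⟨m, hm, hpos⟩ := exists_coord hα
    have hm' (i : Fin 4) : n (-α) i = ((-m) i : ℤ) := by
      simp [n_neg, hm]
    rw [mem_posOf_iff hα hm, Set.image_neg_eq_neg]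
    simp only [Set.mem_union, Set.mem_ofPred_eq, Set.mem_neg, mem_Δkp_iff hα hm,
      mem_Δnp_iff hα hm, mem_Δnp_iff (neg_mem_Δ hα) hm', le'_iff n_long_bound hm,
      le'_iff hm' n_short_bound]
    simp [IsPosCoord, baseCoeff, Fin.forall_fin_succ, Fin.exists_fin_succ] at hpos ⊢
    omega
  ext α
  refine ⟨fun h => (hΔ h.1).1 h, fun h => (hΔ ?_).2 h⟩
  rcases h with (h | h) | ⟨β, hβ, rfl⟩
  · exact h.1.1
  · exact h.1.1.1
  · exact neg_mem_Δ hβ.1.1.1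

theorem stmt9 :
    IsBase ({φ₁ + φ₂ + (2 : ℝ) • φ₃, -(φ₁ + φ₂ + φ₃ + φ₄), φ₂, φ₄} : Finset V) ∧
    posOf ({φ₁ + φ₂ + (2 : ℝ) • φ₃, -(φ₁ + φ₂ + φ₃ + φ₄), φ₂, φ₄} : Finset V) =
      Δkp ∪ {β ∈ Δnp | le' (φ₁ + φ₂ + (2 : ℝ) • φ₃) β} ∪ (Neg.neg '' {β ∈ Δnp | le' β (φ₁ + φ₂ + φ₃ + φ₄)}) ∧
    Δkp ⊆ posOf ({φ₁ + φ₂ + (2 : ℝ) • φ₃, -(φ₁ + φ₂ + φ₃ + φ₄), φ₂, φ₄} : Finset V) := by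
  rw [base_eq_image_baseVec]
  refine ⟨isBase_image_baseVec, posOf_image_baseVec, ?_⟩
  rw [posOf_image_baseVec]
  exact fun α h => .inl (.inl h)
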